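/- (Corollary, action quantization in MDPs.) Consider a finite-horizon MDP with measurable state space 𝒮, finite action space 𝒜, Markov transition kernel P : 𝒮 × 𝒜 → Δ(𝒮), and bounded measurable reward r : 𝒮 × 𝒜 → ℝ, with optimal value functions V_{T+1} ≡ 0, Q_t(s,a) = r(s,a) + ∫ V_{t+1}(s') P(ds'|s,a), V_t(s) = max_{a∈𝒜} Q_t(s,a). Let q : 𝒜 → 𝒜̂ ⊆ 𝒜 be an (ε, δ)-action-quantizer, i.e., |r(s,a) − r(s,q(a))| ≤ ε and d_𝔉(P(·|s,a), P(·|s,q(a))) ≤ δ for all s, a. Define V̂_{T+1} ≡ 0, Q̂_t(s,â) = r(s,â) + ∫ V̂_{t+1}(s') P(ds'|s,â), V̂_t(s) = max_{â∈𝒜̂} Q̂_t(s,â), and let π̂_t be any stochastic policy with Supp(π̂_t(s)) ⊆ argmax_{â∈𝒜̂} Q̂_t(s,â). Then for all t, s, a: |Q_t(s,a) − Q̂_t(s,q(a))| ≤ α_t, |V_t(s) − V̂_t(s)| ≤ α_t, and |V_t(s) − V^{π̂}_t(s)| ≤ α_t (with no factor 2), where α_{T+1} = 0 and α_t = ε +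 ρ_𝔉(V̂_{t+1}) δ + α_{t+1}. -/

import Mathlib

open MeasureTheory ProbabilityTheory

universe u

/-- The integral probability metric (IPM) associated with a function class `F`. -/
noncomputable def ipm {X : Type u} [MeasurableSpace X] (F : Set (X → ℝ))
    (μ ν : Measure X) : ℝ :=
  sSup ((fun f => |∫ x, f x ∂μ - ∫ x, f x ∂ν|) '' F)

/-- The Minkowski functional (gauge) of a function `f` with respect to the class `F`. -/
noncomputable def mink {X : Type u} (F : Set (X → ℝ)) (f : X → ℝ) : ℝ :=
  sInf {c : ℝ | 0 < c ∧ (fun x => c⁻¹ * f x) ∈ F}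

/-- `F` is a class of uniformly bounded measurable real-valued functions. -/
def UnifBddMeas {X : Type u} [MeasurableSpace X] (F : Set (X → ℝ)) : Prop :=
  (∀ f ∈ F, Measurable f) ∧ ∃ C : ℝ, ∀ f ∈ F, ∀ x, |f x| ≤ C

/-- Bounded measurable functions are integrable against every finite measure. -/
theorem integrable_of_measurable_of_bounded {X : Type u} [MeasurableSpace X] {f : X → ℝ}
    (hf : Measurable f) (hb : ∃ C : ℝ, ∀ x, |f x| ≤ C) (μ : Measure X) [IsFiniteMeasure μ] :
    Integrable f μ := by
  obtain ⟨C, hC⟩ := hb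
  exact Integrable.of_bound hf.aestronglyMeasurable C (Filter.Eventually.of_forall hC)

/-- A uniform bound on a function bounds its integral against a probability measure. -/
theorem abs_integral_le_of_abs_le {X : Type u} [MeasurableSpace X] {f : X → ℝ} {C : ℝ}
    (hC : ∀ x, |f x| ≤ C) (μ : Measure X) [IsProbabilityMeasure μ] :
    |∫ x, f x ∂μ| ≤ C := by
  simpa using norm_integral_le_of_norm_le_const (μ := μ) (f := f)
    (Filter.Eventually.of_forall fun x => (Real.norm_eq_abs (f x)).trans_le (hC x))

/-- Every member of a uniformly bounded class is controlled by the associated IPM. -/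
theorem abs_integral_sub_le_ipm {X : Type u} [MeasurableSpace X] {F : Set (X → ℝ)}
    (hF : UnifBddMeas F) (μ ν : Measure X) [IsProbabilityMeasure μ] [IsProbabilityMeasure ν]
    {f : X → ℝ} (hf : f ∈ F) :
    |∫ x, f x ∂μ - ∫ x, f x ∂ν| ≤ ipm F μ ν := by
  obtain ⟨-, C, hC⟩ := hF
  refine le_csSup ⟨C + C, ?_⟩ ⟨f, hf, rfl⟩
  rintro _ ⟨g, hg, rfl⟩
  exact (abs_sub _ _).trans
    (add_le_add (abs_integral_le_of_abs_le (hC g hg) μ) (abs_integral_le_of_abs_le (hC g hg) ν))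

/-- The IPM inequality `|∫ f dμ - ∫ f dν| ≤ ρ_F(f) d_F(μ, ν)`. -/
theorem abs_integral_sub_le_mink_mul {X : Type u} [MeasurableSpace X] {F : Set (X → ℝ)}
    (hF : UnifBddMeas F) (μ ν : Measure X) [IsProbabilityMeasure μ] [IsProbabilityMeasure ν]
    {f : X → ℝ} (hf : {c : ℝ | 0 < c ∧ (fun x => c⁻¹ * f x) ∈ F}.Nonempty)
    {δ : ℝ} (hδ : ipm F μ ν ≤ δ) :
    |∫ x, f x ∂μ - ∫ x, f x ∂ν| ≤ mink F f * δ := by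
  have key : ∀ c ∈ {c : ℝ | 0 < c ∧ (fun x => c⁻¹ * f x) ∈ F},
      |∫ x, f x ∂μ - ∫ x, f x ∂ν| ≤ c * δ := by
    rintro c ⟨hc, hcF⟩
    have h := (abs_integral_sub_le_ipm hF μ ν hcF).trans hδ
    rw [integral_const_mul, integral_const_mul, ← mul_sub, abs_mul,
      abs_of_pos (inv_pos.2 hc)] at h
    rwa [← inv_mul_le_iff₀ hc]
  obtain ⟨c, hc⟩ := hf
  have hδ0 : 0 ≤ δ :=
    (abs_nonneg _).trans ((abs_integral_sub_le_ipm hF μ ν hc.2).trans hδ)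
  rcases hδ0.eq_or_lt with rfl | hpos
  · simpa using key c hc
  · rw [← div_le_iff₀ hpos]
    exact le_csInf ⟨c, hc⟩ fun b hb => (div_le_iff₀ hpos).2 (key b hb)

/-- Functions with finite gauge with respect to a class of bounded measurable functions are
themselves bounded and measurable. -/
theorem measurable_and_bounded_of_mink {X : Type u} [MeasurableSpace X] {F : Set (X → ℝ)}
    (hF : UnifBddMeas F) {f : X → ℝ}
    (hf : {c : ℝ | 0 < c ∧ (fun x => c⁻¹ * f x) ∈ F}.Nonempty) :
    Measurable f ∧ ∃ C : ℝ, ∀ x, |f x| ≤ C := by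
  obtain ⟨c, hc, hcF⟩ := hf
  obtain ⟨hm, C, hC⟩ := hF
  have hfc : f = fun x => c * (c⁻¹ * f x) := by
    funext x
    field_simp
  constructor
  · rw [hfc]
    exact (hm _ hcF).const_mul c
  · refine ⟨c * C, fun x => ?_⟩
    have h := hC _ hcF x
    rwa [abs_mul, abs_of_pos (inv_pos.2 hc), inv_mul_le_iff₀ hc] at h

/-- The Bellman optimality operator preserves bounded measurable functions. -/
theorem bellman_measurable_and_bounded
    {S A : Type u} [MeasurableSpace S] [MeasurableSpace A] [Finite A] [Nonempty A]
    (P : Kernel (S × A) S) [IsMarkovKernel P]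
    {r : S × A → ℝ} (hrm : Measurable r) (hrb : ∃ C : ℝ, ∀ p, |r p| ≤ C)
    {v : S → ℝ} (hvm : Measurable v) (hvb : ∃ C : ℝ, ∀ s, |v s| ≤ C) :
    Measurable (fun s => ⨆ a : A, (r (s, a) + ∫ s', v s' ∂(P (s, a)))) ∧
      ∃ C : ℝ, ∀ s, |⨆ a : A, (r (s, a) + ∫ s', v s' ∂(P (s, a)))| ≤ C := by
  constructor
  · refine Measurable.iSup fun a => ?_
    have hi : Measurable fun p : S × A => ∫ s', v s' ∂(P p) :=
      (hvm.stronglyMeasurable.integral_kernel (κ := P)).measurable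
    exact (hrm.add hi).comp measurable_prodMk_right
  · obtain ⟨C, hC⟩ := hrb
    obtain ⟨D, hD⟩ := hvb
    refine ⟨C + D, fun s => ?_⟩
    have hb : ∀ a : A, |r (s, a) + ∫ s', v s' ∂(P (s, a))| ≤ C + D := fun a =>
      (abs_add_le _ _).trans (add_le_add (hC _) (abs_integral_le_of_abs_le hD _))
    obtain ⟨a, ha⟩ := exists_eq_ciSup_of_finite
      (f := fun a : A => r (s, a) + ∫ s', v s' ∂(P (s, a)))
    rw [← ha]
    exact hb a

/-- If `g ∘ q` is uniformly within `c` of `f` and `q` maps onto `B`, then the maximum of `f` is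
within `c` of the maximum of `g` over `B`. -/
theorem abs_iSup_sub_iSup_le {A : Type u} [Finite A] [Nonempty A] {B : Set A} {q : A → A}
    (hq : ∀ a, q a ∈ B) (hqsurj : ∀ a ∈ B, ∃ a', q a' = a) {f g : A → ℝ} {c : ℝ}
    (h : ∀ a, |f a - g (q a)| ≤ c) :
    |(⨆ a, f a) - ⨆ b : B, g b| ≤ c := by
  have : Nonempty B := ⟨⟨_, hq (Classical.arbitrary A)⟩⟩
  have hf : BddAbove (Set.range f) := Set.finite_range f |>.bddAbove
  have hg : BddAbove (Set.range fun b : B => g b) := Set.finite_range _ |>.bddAbove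
  have h₁ : (⨆ a, f a) ≤ (⨆ b : B, g b) + c := ciSup_le fun a => by
    have := le_ciSup hg ⟨q a, hq a⟩
    have := (abs_le.1 (h a)).2
    linarith
  have h₂ : (⨆ b : B, g b) ≤ (⨆ a, f a) + c := ciSup_le fun b => by
    obtain ⟨a, ha⟩ := hqsurj b b.2
    have := le_ciSup hf a
    have := (abs_le.1 (h a)).1
    rw [ha] at this
    linarith
  exact abs_le.2 ⟨by linarith, by linarith⟩

/-- Averaging a function that is constant on the support of a distribution returns the constant. -/
theorem sum_pmf_toReal_mul_eq {A : Type u} [Fintype A] (p : PMF A) {f : A → ℝ} {c : ℝ}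
    (h : ∀ a ∈ p.support, f a = c) : ∑ a, (p a).toReal * f a = c := by
  have hsum : ∑ a, (p a).toReal = 1 := by
    rw [← ENNReal.toReal_sum fun a _ => p.apply_ne_top a, ← tsum_fintype (L := .unconditional A),
      p.tsum_coe, ENNReal.toReal_one]
  calc ∑ a, (p a).toReal * f a = ∑ a, (p a).toReal * c := by
        refine Finset.sum_congr rfl fun a _ => ?_
        by_cases ha : p a = 0
        · simp [ha]
        · rw [h a ((p.mem_support_iff a).2 ha)]
    _ = c := by rw [← Finset.sum_mul, hsum, one_mul]

/-- **Corollary: action quantization in MDPs.**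
Consider a finite-horizon MDP with measurable state space `S`, finite action space `A`,
Markov transition kernel `P`, and bounded measurable reward `r`, with optimal value functions
`Q_t, V_t`.  Let `q : 𝒜 → 𝒜̂ ⊆ 𝒜` be an `(ε, δ)`-action-quantizer:
`|r(s,a) − r(s,q(a))| ≤ ε` and `d_𝔉(P(·|s,a), P(·|s,q(a))) ≤ δ` for all `s, a`.  Let
`Q̂_t, V̂_t` be the value functions of the quantized-action backward recursion and `π̂` any
stochastic policy supported on the `𝒜̂`-argmax of `Q̂_t(s,·)`, with value functions `V^π̂` in
the original MDP.  Then for all `t, s, a`: `|Q_t(s,a) − Q̂_t(s,q(a))| ≤ α_t`,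
`|V_t(s) − V̂_t(s)| ≤ α_t`, and `|V_t(s) − V^π̂_t(s)| ≤ α_t` (with no factor `2`), where
`α_{T+1} = 0` and `α_t = ε + ρ_𝔉(V̂_{t+1}) δ + α_{t+1}`. -/
theorem mdp_action_quantization
    {S A : Type u} [MeasurableSpace S] [MeasurableSpace A] [Fintype A] [Nonempty A]
    (T : ℕ)
    (P : Kernel (S × A) S) [IsMarkovKernel P]
    (r : S × A → ℝ) (hrm : Measurable r) (hrb : ∃ C : ℝ, ∀ p, |r p| ≤ C)
    -- the quantized action set `𝒜̂ ⊆ 𝒜` and quantizer `q : 𝒜 → 𝒜̂`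
    (Ahat : Set A) (hAhat : Ahat.Nonempty)
    (q : A → A) (hq : ∀ a, q a ∈ Ahat) (hqsurj : ∀ a ∈ Ahat, ∃ a', q a' = a)
    (F : Set (S → ℝ)) (hF : UnifBddMeas F)
    (ε δ : ℝ)
    -- `(ε, δ)`-action-quantizer conditions (AQM1) and (AQM2)
    (hAQM1 : ∀ (s : S) (a : A), |r (s, a) - r (s, q a)| ≤ ε)
    (hAQM2 : ∀ (s : S) (a : A), ipm F (P (s, a)) (P (s, q a)) ≤ δ)
    -- the optimal value functions
    (Q : ℕ → S → A → ℝ) (V : ℕ → S → ℝ)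
    (hVT : ∀ s, V (T+1) s = 0)
    (hQ : ∀ t ≤ T, ∀ (s : S) (a : A),
      Q t s a = r (s, a) + ∫ s', V (t+1) s' ∂(P (s, a)))
    (hV : ∀ t ≤ T, ∀ s : S, V t s = ⨆ a : A, Q t s a)
    -- the quantized-action value functions
    (Qhat : ℕ → S → A → ℝ) (Vhat : ℕ → S → ℝ)
    (hVhatT : ∀ s, Vhat (T+1) s = 0)
    (hQhat : ∀ t ≤ T, ∀ (s : S), ∀ a ∈ Ahat,
      Qhat t s a = r (s, a) + ∫ s', Vhat (t+1) s' ∂(P (s, a)))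
    (hVhat : ∀ t ≤ T, ∀ s : S, Vhat t s = ⨆ a : Ahat, Qhat t s a)
    -- finiteness of the Minkowski functionals ρ_𝔉(V̂_{t+1})
    (hmink : ∀ t ≤ T, {c : ℝ | 0 < c ∧ (fun s => c⁻¹ * Vhat (t+1) s) ∈ F}.Nonempty)
    -- a stochastic policy supported on the `𝒜̂`-argmax of `Qhat`
    (πhat : ℕ → S → PMF A)
    (hgreedy : ∀ t ≤ T, ∀ s : S, ∀ a ∈ (πhat t s).support,
      a ∈ Ahat ∧ Qhat t s a = ⨆ a' : Ahat, Qhat t s a')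
    -- the value functions of `π̂` in the original MDP
    (Qπ : ℕ → S → A → ℝ) (Vπ : ℕ → S → ℝ)
    (hVπT : ∀ s, Vπ (T+1) s = 0)
    (hQπ : ∀ t ≤ T, ∀ (s : S) (a : A),
      Qπ t s a = r (s, a) + ∫ s', Vπ (t+1) s' ∂(P (s, a)))
    (hVπ : ∀ t ≤ T, ∀ s : S,
      Vπ t s = ∑ a : A, ((πhat t s) a).toReal * Qπ t s a)
    -- the error recursion
    (α : ℕ → ℝ) (hαT : α (T+1) = 0)
    (hα : ∀ t ≤ T, α t = ε + mink F (Vhat (t+1)) * δ + α (t+1)) :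
    ∀ t ≤ T, ∀ (s : S) (a : A),
      |Q t s a - Qhat t s (q a)| ≤ α t ∧ |V t s - Vhat t s| ≤ α t ∧
      |V t s - Vπ t s| ≤ α t := by
  have hVreg : ∀ t ≤ T + 1, Measurable (V t) ∧ ∃ C : ℝ, ∀ s, |V t s| ≤ C := by
    intro t ht
    induction ht using Nat.decreasingInduction with
    | self =>
      rw [show V (T + 1) = fun _ => 0 from funext hVT]
      exact ⟨measurable_const, 0, by simp⟩
    | of_succ t ht ih =>
      have hVt : V t = fun s => ⨆ a : A, (r (s, a) + ∫ s', V (t + 1) s' ∂(P (s, a))) := by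
        funext s
        simp only [hV t (by omega), hQ t (by omega)]
      rw [hVt]
      exact bellman_measurable_and_bounded P hrm hrb ih.1 ih.2
  have hπ : ∀ t ≤ T + 1, Vπ t = Vhat t := by
    intro t ht
    induction ht using Nat.decreasingInduction with
    | self => exact funext fun s => by rw [hVπT, hVhatT]
    | of_succ t ht ih =>
      have htT : t ≤ T := by omega
      funext s
      rw [hVπ t htT, hVhat t htT]
      refine sum_pmf_toReal_mul_eq _ fun a ha => ?_
      obtain ⟨haA, hamax⟩ := hgreedy t htT s a ha
      rw [← hamax, hQπ t htT, hQhat t htT s a haA, ih]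
  have hstep : ∀ t ≤ T, (∀ s, |V (t + 1) s - Vhat (t + 1) s| ≤ α (t + 1)) →
      ∀ s a, |Q t s a - Qhat t s (q a)| ≤ α t := by
    intro t ht ih s a
    obtain ⟨hVm, hVb⟩ := hVreg (t + 1) (by omega)
    obtain ⟨hWm, hWb⟩ := measurable_and_bounded_of_mink hF (hmink t ht)
    have hnext := abs_integral_le_of_abs_le ih (P (s, a))
    rw [integral_sub (integrable_of_measurable_of_bounded hVm hVb _)
      (integrable_of_measurable_of_bounded hWm hWb _)] at hnext
    have hker := abs_integral_sub_le_mink_mul hF (P (s, a)) (P (s, q a)) (hmink t ht) (hAQM2 s a)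
    have hrew := hAQM1 s a
    rw [hQ t ht, hQhat t ht s _ (hq a), hα t ht]
    rw [abs_le] at *
    constructor <;> linarith
  have hVdiff : ∀ t ≤ T + 1, ∀ s, |V t s - Vhat t s| ≤ α t := by
    intro t ht
    induction ht using Nat.decreasingInduction with
    | self => intro s; simp [hVT, hVhatT, hαT]
    | of_succ t ht ih =>
      have htT : t ≤ T := by omega
      intro s
      rw [hV t htT, hVhat t htT]
      exact abs_iSup_sub_iSup_le hq hqsurj (hstep t htT ih s)
  intro t ht s a
  have hv := hVdiff t (by omega) s
  refine ⟨hstep t ht (hVdiff (t + 1) (by omega)) s a, hv, ?_⟩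
  rwa [hπ t (by omega)]
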